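/- Let n ≥ 1 be a natural number and let V : ℕ → ℕ → ℤ satisfy V_r(0) = 1 for all r and V_r(k) = 2·(n - r - k)·V_r(k-1) - 2·(n - 2r - δ(n-1))·V_{r+1}(k-1) whenever k ≥ 1 and r + k ≤ ⌊n/2⌋. Then V_0(⌊n/2⌋) = c · ∏_{j=1}^{⌊n/2⌋}(n - j), where c = 2 if n ≡ 0 (mod 8), c = 1 if n ≡ 1 or 7 (mod 8), c = 0 if n ≡ 2 or 6 (mod 8), c = -1 if n ≡ 3 or 5 (mod 8), and c = -2 if n ≡ 4 (mod 8). -/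

import Mathlib

/-- The values `k! [xᵏ] (1 + 2x)ᵃ (1 - 2x)ᵃ⁻ˢ` with `a = (m - 1) / 2`, defined through the
three-term recurrence coming from the differential equation of this series. -/
def expCoeff (m s : ℤ) : ℕ → ℤ
  | 0 => 1
  | 1 => 2 * s
  | k + 2 => 2 * s * expCoeff m s (k + 1) - 4 * (k + 1) * (m - s - k - 1) * expCoeff m s k

/-- Multiplying the series for `s + 1` by `1 - 2x` gives the series for `s`. -/
theorem expCoeff_add_one_succ (m s : ℤ) (k : ℕ) :
    expCoeff m (s + 1) (k + 1) =
      expCoeff m s (k + 1) + 2 * (k + 1) * expCoeff m (s + 1) k := by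
  induction k using Nat.twoStepInduction with
  | zero => simp [expCoeff]; ring
  | one => simp [expCoeff]; ring
  | more k ih₀ ih₁ =>
    have e₁ : expCoeff m (s + 1) (k + 3) = _ := expCoeff.eq_3 m (s + 1) (k + 1)
    have e₂ : expCoeff m (s + 1) (k + 2) = _ := expCoeff.eq_3 m (s + 1) k
    have e₃ : expCoeff m s (k + 3) = _ := expCoeff.eq_3 m s (k + 1)
    rw [e₁, e₃]
    push_cast at *
    linear_combination (2 * s) * ih₁ - 4 * (k + 2) * (m - s - k - 2) * ih₀
      + (-2 * (k + 2)) * e₂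

theorem expCoeff_succ (m s : ℤ) (k : ℕ) :
    expCoeff m s (k + 1) = 2 * (m - s - (k + 1)) * expCoeff m s k
      - 2 * (m - 2 * s - 1) * expCoeff m (s + 1) k := by
  induction k with
  | zero => simp [expCoeff]; ring
  | succ k ih =>
    rw [expCoeff.eq_3, expCoeff_add_one_succ]
    push_cast
    linear_combination 2 * (k + 1) * ih

theorem expCoeff_zero_odd (m : ℤ) (j : ℕ) : expCoeff m 0 (2 * j + 1) = 0 := by
  induction j with
  | zero => simp [expCoeff]
  | succ j ih => rw [show 2 * (j + 1) + 1 = 2 * j + 1 + 2 by ring, expCoeff.eq_3, ih]; ring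

theorem expCoeff_zero_even (m : ℤ) (j : ℕ) :
    expCoeff m 0 (2 * j) = (-4) ^ j *
      ((∏ i ∈ Finset.range j, (2 * (i : ℤ) + 1)) *
        ∏ i ∈ Finset.range j, (m - 2 * i - 1)) := by
  induction j with
  | zero => simp [expCoeff]
  | succ j ih =>
    rw [show 2 * (j + 1) = 2 * j + 2 by ring, expCoeff.eq_3, ih, Finset.prod_range_succ,
      Finset.prod_range_succ]
    push_cast
    ring

theorem expCoeff_four_mul (j : ℕ) :
    expCoeff (4 * j) 0 (2 * j) =
      (-1) ^ j * ∏ i ∈ Finset.range (2 * j), (2 * (2 * (i : ℤ) + 1)) := by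
  have h : ∏ i ∈ Finset.range j, (4 * (j : ℤ) - 2 * i - 1) =
      ∏ i ∈ Finset.range j, (2 * ((j + i : ℕ) : ℤ) + 1) := by
    rw [← Finset.prod_range_reflect]
    refine Finset.prod_congr rfl fun i hi => ?_
    rw [Finset.mem_range] at hi
    rw [Nat.sub_sub, Nat.cast_sub (by omega)]
    push_cast
    ring
  rw [expCoeff_zero_even, h, Finset.prod_mul_distrib, Finset.prod_const,
    Finset.card_range, pow_mul, two_mul j, Finset.prod_range_add,
    show (-4 : ℤ) = -1 * 2 ^ 2 by norm_num, mul_pow]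
  ring

theorem expCoeff_four_mul_add_two (j : ℕ) :
    2 * (2 * j + 1) * expCoeff (4 * j + 2) 0 (2 * j) =
      (-1) ^ j * ∏ i ∈ Finset.range (2 * j + 1), (2 * (2 * (i : ℤ) + 1)) := by
  have h : ∏ i ∈ Finset.range j, (4 * (j : ℤ) + 2 - 2 * i - 1) =
      ∏ i ∈ Finset.range j, (2 * ((j + 1 + i : ℕ) : ℤ) + 1) := by
    rw [← Finset.prod_range_reflect]
    refine Finset.prod_congr rfl fun i hi => ?_
    rw [Finset.mem_range] at hi
    rw [Nat.sub_sub, Nat.cast_sub (by omega)]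
    push_cast
    ring
  rw [expCoeff_zero_even, h, Finset.prod_mul_distrib, Finset.prod_const,
    Finset.card_range, pow_succ, pow_mul, show 2 * j + 1 = j + 1 + j by ring,
    Finset.prod_range_add, Finset.prod_range_succ,
    show (-4 : ℤ) = -1 * 2 ^ 2 by norm_num, mul_pow]
  ring

theorem prod_range_add_one_add (h : ℕ) :
    ∏ i ∈ Finset.range h, ((h : ℤ) + 1 + i) =
      ∏ i ∈ Finset.range h, (2 * (2 * (i : ℤ) + 1)) := by
  induction h with
  | zero => simp
  | succ h ih =>
    have e := Finset.prod_range_succ' (fun i : ℕ => (h : ℤ) + 1 + i) (h + 1)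
    rw [Finset.prod_range_succ, Finset.prod_range_succ, ih] at e
    have c : ∏ i ∈ Finset.range (h + 1), (((h + 1 : ℕ) : ℤ) + 1 + i) =
        ∏ i ∈ Finset.range (h + 1), ((h : ℤ) + 1 + ((i + 1 : ℕ) : ℤ)) :=
      Finset.prod_congr rfl fun i _ => by push_cast; ring
    rw [c, Finset.prod_range_succ (fun i : ℕ => 2 * (2 * (i : ℤ) + 1))]
    have hne : (h : ℤ) + 1 ≠ 0 := by positivity
    apply mul_right_cancel₀ hne
    push_cast at e ⊢
    linear_combination -e

theorem prod_Icc_sub (a : ℤ) (h : ℕ) :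
    ∏ j ∈ Finset.Icc 1 h, (a - j) = ∏ i ∈ Finset.range h, (a - h + i) := by
  rw [← Finset.prod_range_reflect, Finset.range_eq_Ico, ← Finset.Ico_add_one_right_eq_Icc,
    Finset.prod_Ico_eq_prod_range, Nat.add_sub_cancel, Finset.range_eq_Ico]
  refine Finset.prod_congr rfl fun i hi => ?_
  rw [Finset.mem_Ico] at hi
  rw [Nat.sub_sub, Nat.cast_sub (by omega)]
  push_cast
  ring

theorem prod_Icc_two_mul_add_one_sub (h : ℕ) :
    ∏ j ∈ Finset.Icc 1 h, (2 * (h : ℤ) + 1 - j) =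
      ∏ i ∈ Finset.range h, (2 * (2 * (i : ℤ) + 1)) := by
  rw [prod_Icc_sub, ← prod_range_add_one_add]
  exact Finset.prod_congr rfl fun i _ => by ring

theorem two_mul_prod_Icc_two_mul_sub (h : ℕ) (hh : h ≠ 0) :
    2 * ∏ j ∈ Finset.Icc 1 h, (2 * (h : ℤ) - j) =
      ∏ i ∈ Finset.range h, (2 * (2 * (i : ℤ) + 1)) := by
  rw [prod_Icc_sub, ← prod_range_add_one_add]
  have e := Finset.prod_range_succ' (fun i : ℕ => (h : ℤ) + i) h
  rw [Finset.prod_range_succ] at e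
  have c₁ : ∏ i ∈ Finset.range h, (2 * (h : ℤ) - h + i) = ∏ i ∈ Finset.range h, ((h : ℤ) + i) :=
    Finset.prod_congr rfl fun i _ => by ring
  have c₂ : ∏ i ∈ Finset.range h, ((h : ℤ) + 1 + i) =
      ∏ i ∈ Finset.range h, ((h : ℤ) + ((i + 1 : ℕ) : ℤ)) :=
    Finset.prod_congr rfl fun i _ => by push_cast; ring
  rw [c₁, c₂]
  have hne : (h : ℤ) ≠ 0 := by exact_mod_cast hh
  apply mul_right_cancel₀ hne
  push_cast at e ⊢
  linear_combination e

/-- A triangular array satisfying the recurrence of `expCoeff_succ` consists of the values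
of `expCoeff`. -/
theorem eq_expCoeff_of_recurrence {V : ℕ → ℕ → ℤ} {N : ℕ} (m t : ℤ) (hV0 : ∀ r, V r 0 = 1)
    (hV : ∀ r k : ℕ, r + (k + 1) ≤ N →
      V r (k + 1) = 2 * (m - (r + t) - (k + 1)) * V r k
        - 2 * (m - 2 * (r + t) - 1) * V (r + 1) k)
    (k r : ℕ) (h : r + k ≤ N) : V r k = expCoeff m (r + t) k := by
  induction k generalizing r with
  | zero => rw [hV0, expCoeff]
  | succ k ih =>
    rw [hV r k h, ih r (by omega), ih (r + 1) (by omega), expCoeff_succ]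
    push_cast
    rw [add_right_comm (r : ℤ) 1 t]


theorem omega_mod_eight
    (n : ℕ) (hn : 1 ≤ n)
    (V : ℕ → ℕ → ℤ)
    (hV0 : ∀ r, V r 0 = 1)
    (hV : ∀ r k, 1 ≤ k → r + k ≤ n / 2 →
      V r k = 2 * ((n : ℤ) - r - k) * V r (k - 1)
        - 2 * ((n : ℤ) - 2 * r - ((n - 1) % 2 : ℕ)) * V (r + 1) (k - 1)) :
    V 0 (n / 2) =
      (if n % 8 = 0 then 2
        else if n % 8 = 1 ∨ n % 8 = 7 then 1
        else if n % 8 = 2 ∨ n % 8 = 6 then 0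
        else if n % 8 = 3 ∨ n % 8 = 5 then -1
        else -2 : ℤ) * ∏ j ∈ Finset.Icc 1 (n / 2), ((n : ℤ) - j) := by
  obtain ⟨h, rfl | rfl⟩ := Nat.even_or_odd' n
  · have hdiv : 2 * h / 2 = h := by omega
    have hδ : (2 * h - 1) % 2 = 1 := by omega
    rw [hdiv, hδ] at hV
    rw [hdiv, eq_expCoeff_of_recurrence (2 * h) 0 hV0 (fun r k hk => by
      rw [hV r (k + 1) (by omega) hk, Nat.add_sub_cancel]; push_cast; ring) h 0 (by omega)]
    have hprod := two_mul_prod_Icc_two_mul_sub h (by omega)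
    push_cast
    obtain ⟨j, rfl | rfl⟩ := Nat.even_or_odd' h
    · have hval := expCoeff_four_mul j
      rw [← hprod] at hval
      push_cast at hval ⊢
      rw [← mul_assoc 2 2 (j : ℤ)] at hval ⊢
      norm_num at hval ⊢
      rw [hval]
      obtain ⟨i, rfl | rfl⟩ := Nat.even_or_odd' j
      · rw [if_pos (by omega)]
        simp
      · rw [if_neg (by omega), if_neg (by omega), if_neg (by omega), if_neg (by omega)]
        simp [pow_succ]
    · rw [expCoeff_zero_odd, if_neg (by omega), if_neg (by omega), if_pos (by omega), zero_mul]
  · have hdiv : (2 * h + 1) / 2 = h := by omega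
    have hδ : (2 * h + 1 - 1) % 2 = 0 := by omega
    rw [hdiv, hδ] at hV
    rw [hdiv, eq_expCoeff_of_recurrence (2 * h) (-1) hV0 (fun r k hk => by
      rw [hV r (k + 1) (by omega) hk, Nat.add_sub_cancel]; push_cast; ring) h 0 (by omega)]
    push_cast
    rw [prod_Icc_two_mul_add_one_sub]
    obtain ⟨j, rfl | rfl⟩ := Nat.even_or_odd' h
    · have hval : expCoeff (2 * (2 * j : ℕ)) (-1) (2 * j) = expCoeff (4 * j) 0 (2 * j) := by
        rw [show (2 * (2 * j : ℕ) : ℤ) = 4 * j by push_cast; ring]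
        cases j with
        | zero => simp [expCoeff]
        | succ j =>
          have e := expCoeff_add_one_succ (4 * (j + 1 : ℕ)) (-1) (2 * j + 1)
          rw [neg_add_cancel, expCoeff_zero_odd, mul_zero, add_zero] at e
          exact e.symm
      rw [hval, expCoeff_four_mul]
      obtain ⟨i, rfl | rfl⟩ := Nat.even_or_odd' j
      · rw [if_neg (by omega), if_pos (by omega)]
        simp
      · rw [if_neg (by omega), if_neg (by omega), if_neg (by omega), if_pos (by omega)]
        simp [pow_succ]
    · have e := expCoeff_add_one_succ (4 * j + 2) (-1) (2 * j)
      rw [neg_add_cancel, expCoeff_zero_odd] at e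
      have hval := expCoeff_four_mul_add_two j
      rw [show (2 * (2 * j + 1 : ℕ) : ℤ) = 4 * j + 2 by push_cast; ring]
      push_cast at e
      rw [hval] at e
      rw [eq_neg_of_add_eq_zero_left e.symm]
      obtain ⟨i, rfl | rfl⟩ := Nat.even_or_odd' j
      · rw [if_neg (by omega), if_neg (by omega), if_neg (by omega), if_pos (by omega)]
        simp
      · rw [if_neg (by omega), if_pos (by omega)]
        simp [pow_succ]
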